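/- Let γ* be the minimizer of F over the nonnegative orthant (ε > 0, ρ > 0). Then there exist dual vectors u : I → ℝ and v : J → ℝ such that γ* i j = exp((u i + v j − c i j)/ε) for all i, j; moreover one can take u i = −ρ·log((Σ_j γ* i j)/p i) and v j = −ρ·log((Σ_i γ* i j)/q j). -/

import Mathlib

open Finset Real

/-- Entropy `H(γ) = -∑_{i,j} γ i j (log γ i j - 1)` (convention `0·log 0 = 0`). -/
noncomputable def entH {I J : Type*} [Fintype I] [Fintype J] (γ : I → J → ℝ) : ℝ :=
  -∑ i, ∑ j, γ i j * (Real.log (γ i j) - 1)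

/-- Kullback–Leibler divergence `KL(h‖p) = ∑_i (h i log(h i / p i) - h i + p i)`. -/
noncomputable def klD {I : Type*} [Fintype I] (h p : I → ℝ) : ℝ :=
  ∑ i, (h i * Real.log (h i / p i) - h i + p i)

/-- Unbalanced entropic optimal transport objective. -/
noncomputable def Fobj {I J : Type*} [Fintype I] [Fintype J]
    (c : I → J → ℝ) (p : I → ℝ) (q : J → ℝ) (ε ρ : ℝ) (γ : I → J → ℝ) : ℝ :=
  (∑ i, ∑ j, c i j * γ i j) - ε * entH γ
    + ρ * klD (fun i => ∑ j, γ i j) p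
    + ρ * klD (fun j => ∑ i, γ i j) q

theorem aux_sum {I : Type*} [Fintype I] [DecidableEq I] (f g : I → ℝ) (i0 : I)
    (h : ∀ i, i ≠ i0 → g i = f i) : ∑ i, g i = ∑ i, f i + (g i0 - f i0) := by
  have h1 := Finset.add_sum_erase Finset.univ f (Finset.mem_univ i0)
  have h2 := Finset.add_sum_erase Finset.univ g (Finset.mem_univ i0)
  have h3 : ∑ x ∈ Finset.univ.erase i0, g x = ∑ x ∈ Finset.univ.erase i0, f x :=
    Finset.sum_congr rfl fun x hx => h x (Finset.ne_of_mem_erase hx)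
  linarith

theorem aux_sum2 {I J : Type*} [Fintype I] [Fintype J] [DecidableEq I] [DecidableEq J]
    (f g : I → J → ℝ) (i0 : I) (j0 : J)
    (h : ∀ i j, ¬ (i = i0 ∧ j = j0) → g i j = f i j) :
    ∑ i, ∑ j, g i j = ∑ i, ∑ j, f i j + (g i0 j0 - f i0 j0) := by
  rw [aux_sum (fun i => ∑ j, f i j) (fun i => ∑ j, g i j) i0
    (fun i hi => Finset.sum_congr rfl fun j _ => h i j (by tauto)),
    aux_sum (f i0) (g i0) j0 (fun j hj => h i0 j (by tauto))]
  ring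

/-- One-variable restriction of the objective. -/
noncomputable def auxG (c p q ε ρ g a b t : ℝ) : ℝ :=
  c * t + ε * ((g + t) * (Real.log (g + t) - 1))
    + ρ * ((a + t) * Real.log ((a + t) / p) - (a + t) + p)
    + ρ * ((b + t) * Real.log ((b + t) / q) - (b + t) + q)

theorem aux_F {I J : Type*} [Fintype I] [Fintype J] [DecidableEq I] [DecidableEq J]
    (c : I → J → ℝ) (p : I → ℝ) (q : J → ℝ) (ε ρ : ℝ) (γ : I → J → ℝ) (i0 : I) (j0 : J)
    (t : ℝ) :
    Fobj c p q ε ρ (fun i j => γ i j + if i = i0 ∧ j = j0 then t else 0) - Fobj c p q ε ρ γ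
     = auxG (c i0 j0) (p i0) (q j0) ε ρ (γ i0 j0) (∑ j, γ i0 j) (∑ i, γ i j0) t
      - auxG (c i0 j0) (p i0) (q j0) ε ρ (γ i0 j0) (∑ j, γ i0 j) (∑ i, γ i j0) 0 := by
  have ha : ∀ i, ∑ j, (γ i j + if i = i0 ∧ j = j0 then t else 0)
      = (∑ j, γ i j) + if i = i0 then t else 0 := by
    intro i
    rw [aux_sum (γ i) _ j0 (fun j hj => by simp [hj])]
    simp
  have hb : ∀ j, ∑ i, (γ i j + if i = i0 ∧ j = j0 then t else 0)
      = (∑ i, γ i j) + if j = j0 then t else 0 := by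
    intro j
    rw [aux_sum (fun i => γ i j) _ i0 (fun j hj => by simp [hj])]
    simp
  unfold Fobj entH klD
  simp only [ha, hb]
  rw [aux_sum2 (fun i j => c i j * γ i j)
      (fun i j => c i j * (γ i j + if i = i0 ∧ j = j0 then t else 0)) i0 j0
      (fun i j h => by simp [h]),
    aux_sum2 (fun i j => γ i j * (Real.log (γ i j) - 1))
      (fun i j => (γ i j + if i = i0 ∧ j = j0 then t else 0) *
        (Real.log (γ i j + if i = i0 ∧ j = j0 then t else 0) - 1)) i0 j0
      (fun i j h => by simp [h]),
    aux_sum (fun i => (∑ j, γ i j) * Real.log ((∑ j, γ i j) / p i) - (∑ j, γ i j) + p i)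
      (fun i => ((∑ j, γ i j) + if i = i0 then t else 0) *
        Real.log (((∑ j, γ i j) + if i = i0 then t else 0) / p i)
        - ((∑ j, γ i j) + if i = i0 then t else 0) + p i) i0 (fun i h => by simp [h]),
    aux_sum (fun j => (∑ i, γ i j) * Real.log ((∑ i, γ i j) / q j) - (∑ i, γ i j) + q j)
      (fun j => ((∑ i, γ i j) + if j = j0 then t else 0) *
        Real.log (((∑ i, γ i j) + if j = j0 then t else 0) / q j)
        - ((∑ i, γ i j) + if j = j0 then t else 0) + q j) j0 (fun i h => by simp [h])]
  simp only [and_self, if_true, auxG, add_zero, mul_zero]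
  ring

theorem aux_deriv1 (p a t : ℝ) (hp : 0 < p) (h : 0 < a + t) :
    HasDerivAt (fun t => (a + t) * Real.log ((a + t) / p) - (a + t) + p)
      (Real.log ((a + t) / p)) t := by
  have h1 : HasDerivAt (fun t : ℝ => a + t) 1 t := (hasDerivAt_id t).const_add a
  have h2 := (h1.div_const p).log (by positivity)
  have h3 := ((h1.mul h2).sub h1).add_const p
  refine h3.congr_deriv ?_
  have hne := h.ne'
  field_simp
  ring

theorem aux_deriv2 (g t : ℝ) (h : 0 < g + t) :
    HasDerivAt (fun t => (g + t) * (Real.log (g + t) - 1)) (Real.log (g + t)) t := by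
  have h1 : HasDerivAt (fun t : ℝ => g + t) 1 t := (hasDerivAt_id t).const_add g
  have h2 := (h1.log h.ne').sub_const 1
  have h3 := h1.mul h2
  refine h3.congr_deriv ?_
  have hne := h.ne'
  field_simp
  ring

theorem aux_deriv (c p q ε ρ g a b t : ℝ) (hp : 0 < p) (hq : 0 < q)
    (hg : 0 < g + t) (ha : 0 < a + t) (hb : 0 < b + t) :
    HasDerivAt (auxG c p q ε ρ g a b)
      (c + ε * Real.log (g + t) + ρ * Real.log ((a + t) / p) + ρ * Real.log ((b + t) / q)) t := by
  have h0 : HasDerivAt (fun t : ℝ => c * t) c t := by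
    simpa using (hasDerivAt_id t).const_mul c
  exact ((h0.add ((aux_deriv2 g t hg).const_mul ε)).add
    ((aux_deriv1 p a t hp ha).const_mul ρ)).add ((aux_deriv1 q b t hq hb).const_mul ρ)

theorem aux_cont1 (p a : ℝ) (hp : 0 < p) :
    Continuous (fun t => (a + t) * Real.log ((a + t) / p) - (a + t) + p) := by
  have h : Continuous (fun t : ℝ => p * (((a + t) / p) * Real.log ((a + t) / p))) :=
    continuous_const.mul (Real.continuous_mul_log.comp (f := fun t : ℝ => (a + t) / p)
      (by fun_prop))
  have h' : (fun t : ℝ => (a + t) * Real.log ((a + t) / p) - (a + t) + p)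
      = fun t => p * (((a + t) / p) * Real.log ((a + t) / p)) - (a + t) + p := by
    funext t
    field_simp
  rw [h']
  fun_prop

theorem aux_cont (c p q ε ρ g a b : ℝ) (hp : 0 < p) (hq : 0 < q) :
    Continuous (auxG c p q ε ρ g a b) := by
  have h2 : Continuous (fun t : ℝ => (g + t) * (Real.log (g + t) - 1)) := by
    have h := Real.continuous_mul_log.comp (f := fun t : ℝ => g + t) (by fun_prop)
    have h' : (fun t : ℝ => (g + t) * (Real.log (g + t) - 1))
      = fun t => ((fun x => x * Real.log x) ∘ (fun t : ℝ => g + t)) t - (g + t) := by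
      funext t
      simp only [Function.comp]
      ring
    rw [h']
    exact h.sub (by fun_prop)
  exact (((continuous_const.mul continuous_id).add (continuous_const.mul h2)).add
    (continuous_const.mul (aux_cont1 p a hp))).add (continuous_const.mul (aux_cont1 q b hq))

theorem aux_pos (c p q ε ρ a b : ℝ) (hp : 0 < p) (hq : 0 < q) (hε : 0 < ε) (hρ : 0 < ρ)
    (ha : 0 ≤ a) (hb : 0 ≤ b) :
    ∃ t, 0 < t ∧ auxG c p q ε ρ 0 a b t < auxG c p q ε ρ 0 a b 0 := by
  set M := c + ρ * Real.log ((a + 1) / p) + ρ * Real.log ((b + 1) / q) with hM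
  set d := min 1 (Real.exp (-M / ε)) with hd
  have hd0 : 0 < d := lt_min one_pos (Real.exp_pos _)
  refine ⟨d, hd0, ?_⟩
  have hanti : StrictAntiOn (auxG c p q ε ρ 0 a b) (Set.Icc 0 d) := by
    apply strictAntiOn_of_deriv_neg (convex_Icc 0 d) (aux_cont c p q ε ρ 0 a b hp hq).continuousOn
    intro t ht
    rw [interior_Icc] at ht
    obtain ⟨ht0, htd⟩ := ht
    have ht1 : t < 1 := htd.trans_le (min_le_left _ _)
    have ht2 : t < Real.exp (-M / ε) := htd.trans_le (min_le_right _ _)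
    rw [(aux_deriv c p q ε ρ 0 a b t hp hq (by linarith) (by linarith) (by linarith)).deriv]
    have e1 : Real.log t < -M / ε := (Real.log_lt_iff_lt_exp ht0).2 ht2
    have e2 : Real.log ((a + t) / p) ≤ Real.log ((a + 1) / p) :=
      Real.log_le_log (by positivity) (by gcongr)
    have e3 : Real.log ((b + t) / q) ≤ Real.log ((b + 1) / q) :=
      Real.log_le_log (by positivity) (by gcongr)
    have e1' : ε * Real.log t < -M := by
      rw [lt_div_iff₀ hε] at e1
      linarith
    have e2' := mul_le_mul_of_nonneg_left e2 hρ.le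
    have e3' := mul_le_mul_of_nonneg_left e3 hρ.le
    rw [zero_add]
    linarith
  exact hanti ⟨le_rfl, hd0.le⟩ ⟨hd0.le, le_rfl⟩ hd0

/-- At the minimizer there exist dual vectors `u, v` with
`γ* i j = exp((u i + v j - c i j)/ε)`, and one can take
`u i = -ρ log((∑_j γ* i j)/p i)`, `v j = -ρ log((∑_i γ* i j)/q j)`. -/
theorem stmt_3 {I J : Type*} [Fintype I] [Fintype J] [Nonempty I] [Nonempty J]
    (c : I → J → ℝ) (p : I → ℝ) (q : J → ℝ) (hp : ∀ i, 0 < p i) (hq : ∀ j, 0 < q j)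
    (ε ρ : ℝ) (hε : 0 < ε) (hρ : 0 < ρ)
    (γstar : I → J → ℝ) (hnn : ∀ i j, 0 ≤ γstar i j)
    (hmin : ∀ γ : I → J → ℝ, (∀ i j, 0 ≤ γ i j) →
      Fobj c p q ε ρ γstar ≤ Fobj c p q ε ρ γ) :
    ∃ u : I → ℝ, ∃ v : J → ℝ,
      (∀ i j, γstar i j = Real.exp ((u i + v j - c i j) / ε)) ∧
      (∀ i, u i = -ρ * Real.log ((∑ j, γstar i j) / p i)) ∧
      (∀ j, v j = -ρ * Real.log ((∑ i, γstar i j) / q j)) := by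
  classical
  have hG : ∀ i j t, 0 ≤ γstar i j + t →
      auxG (c i j) (p i) (q j) ε ρ (γstar i j) (∑ j, γstar i j) (∑ i, γstar i j) 0 ≤
      auxG (c i j) (p i) (q j) ε ρ (γstar i j) (∑ j, γstar i j) (∑ i, γstar i j) t := by
    intro i j t ht
    have h1 := aux_F c p q ε ρ γstar i j t
    have h2 := hmin (fun i' j' => γstar i' j' + if i' = i ∧ j' = j then t else 0) (by
      intro i' j'
      by_cases h : i' = i ∧ j' = j
      · obtain ⟨rfl, rfl⟩ := h
        simpa using ht
      · simpa [h] using hnn i' j')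
    linarith
  have ha : ∀ i, 0 ≤ ∑ j, γstar i j := fun i => Finset.sum_nonneg fun j _ => hnn i j
  have hb : ∀ j, 0 ≤ ∑ i, γstar i j := fun j => Finset.sum_nonneg fun i _ => hnn i j
  have hpos : ∀ i j, 0 < γstar i j := by
    intro i j
    by_contra hcon
    have h0 : γstar i j = 0 := le_antisymm (not_lt.1 hcon) (hnn i j)
    obtain ⟨t, ht, hlt⟩ := aux_pos (c i j) (p i) (q j) ε ρ _ _ (hp i) (hq j) hε hρ (ha i) (hb j)
    have := hG i j t (by linarith)
    rw [h0] at this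
    linarith
  refine ⟨fun i => -ρ * Real.log ((∑ j, γstar i j) / p i),
    fun j => -ρ * Real.log ((∑ i, γstar i j) / q j), ?_, fun _ => rfl, fun _ => rfl⟩
  intro i j
  have hap : 0 < ∑ j, γstar i j := Finset.sum_pos (fun j _ => hpos i j) Finset.univ_nonempty
  have hbp : 0 < ∑ i, γstar i j := Finset.sum_pos (fun i _ => hpos i j) Finset.univ_nonempty
  have hder := aux_deriv (c i j) (p i) (q j) ε ρ (γstar i j) _ _ 0 (hp i) (hq j)
    (by simpa using hpos i j) (by simpa using hap) (by simpa using hbp)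
  have hloc : IsLocalMin (auxG (c i j) (p i) (q j) ε ρ (γstar i j) (∑ j, γstar i j)
      (∑ i, γstar i j)) 0 := by
    filter_upwards [Ioi_mem_nhds (show -γstar i j < 0 by linarith [hpos i j])] with t ht
    exact hG i j t (by have := Set.mem_Ioi.1 ht; linarith)
  have hz := hloc.hasDerivAt_eq_zero hder
  simp only [add_zero] at hz
  rw [← Real.exp_log (hpos i j)]
  simp only [Real.exp_log (hpos _ _)]
  have hl : Real.log (γstar i j) = (-ρ * Real.log ((∑ j, γstar i j) / p i) +
      -ρ * Real.log ((∑ i, γstar i j) / q j) - c i j) / ε := by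
    rw [eq_div_iff hε.ne']
    linarith
  rw [← hl, Real.exp_log (hpos i j)]
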